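/- arXiv:2605.21041 — 3 statements merged into one kernel-verified Lean document; each statement's English description precedes it below -/
import Mathlib

section
/- Let K be a real symmetric positive definite m × m matrix whose eigenvalues all lie in (0, 1), let m⋆ ∈ ℝ^m, z ∈ ℝ^m, and let α : [0, 1] → (0, 1] be differentiable with α(0) = 1. Define β(t) := −2 α'(t)/α(t), b(t) := α(t) m⋆, A(t) := α(t)² K + (1 − α(t)²) I (which is symmetric positive definite for every t), and f(t) := b(t) + √(A(t)) z, where √(A(t)) denotes the unique symmetric positive definite square root of A(t). Then f is differentiable on [0, 1] and satisfies the linear time-varying ODE f'(t) = −(1/2) β(t) A(t)⁻¹ b(t) − (1/2) β(t) (I − A(t)⁻¹) f(t). -/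
open Matrix

open scoped MatrixOrder in
theorem psd_sqrt_unique_aux {m : ℕ} {S T : Matrix (Fin m) (Fin m) ℝ} (hS : S.PosSemidef)
    (hT : T.PosSemidef) (h : S * S = T * T) : S = T :=
  (CFC.mul_self_eq_mul_self_iff S T hS.nonneg hT.nonneg).1 h

/-- The GP flow-map ODE: for a real symmetric positive definite matrix `K` with eigenvalues
in `(0, 1)`, `m⋆, z ∈ ℝ^m`, and a differentiable schedule `α : [0,1] → (0,1]` with
`α(0) = 1`, define `β(t) := −2 α'(t)/α(t)`, `b(t) := α(t) m⋆`,
`A(t) := α(t)² K + (1 − α(t)²) I` (symmetric positive definite for every `t ∈ [0,1]`), and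
`f(t) := b(t) + √(A(t)) z`, where `√(A(t))` is the unique symmetric positive semidefinite
square root of `A(t)` (characterised by being positive semidefinite and squaring to
`A(t)`). Then `f` is differentiable on `[0, 1]` and satisfies the linear time-varying ODE
`f'(t) = −(1/2) β(t) A(t)⁻¹ b(t) − (1/2) β(t) (I − A(t)⁻¹) f(t)`. -/
theorem stmt9 {m : ℕ}
    (K : Matrix (Fin m) (Fin m) ℝ) (hK : K.PosDef)
    (heig : ∀ i, hK.1.eigenvalues i ∈ Set.Ioo (0 : ℝ) 1)
    (mstar z : Fin m → ℝ)
    (α α' : ℝ → ℝ)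
    (hα : ∀ t ∈ Set.Icc (0 : ℝ) 1, HasDerivWithinAt α (α' t) (Set.Icc (0 : ℝ) 1) t)
    (hα0 : α 0 = 1)
    (hαrange : ∀ t ∈ Set.Icc (0 : ℝ) 1, α t ∈ Set.Ioc (0 : ℝ) 1)
    (β : ℝ → ℝ) (hβ : ∀ t, β t = -2 * α' t / α t)
    (b : ℝ → Fin m → ℝ) (hb : ∀ t, b t = α t • mstar)
    (A : ℝ → Matrix (Fin m) (Fin m) ℝ)
    (hA : ∀ t, A t = α t ^ 2 • K + (1 - α t ^ 2) • (1 : Matrix (Fin m) (Fin m) ℝ))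
    (hApd : ∀ t ∈ Set.Icc (0 : ℝ) 1, (A t).PosDef)
    (sqrtA : ℝ → Matrix (Fin m) (Fin m) ℝ)
    (hsqrtA : ∀ t ∈ Set.Icc (0 : ℝ) 1,
      (sqrtA t).PosSemidef ∧ sqrtA t * sqrtA t = A t)
    (f : ℝ → Fin m → ℝ)
    (hf : ∀ t ∈ Set.Icc (0 : ℝ) 1, f t = b t + (sqrtA t).mulVec z) :
    ∀ t ∈ Set.Icc (0 : ℝ) 1,
      HasDerivWithinAt f
        (-((1 / 2 : ℝ) * β t) • ((A t)⁻¹.mulVec (b t))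
          - ((1 / 2 : ℝ) * β t) •
              (((1 : Matrix (Fin m) (Fin m) ℝ) - (A t)⁻¹).mulVec (f t)))
        (Set.Icc (0 : ℝ) 1) t := by
  intro t ht
  obtain ⟨U, hUU, hUU2, hKU⟩ : ∃ U : Matrix (Fin m) (Fin m) ℝ, U * Uᴴ = 1 ∧ Uᴴ * U = 1 ∧
      K = U * diagonal hK.1.eigenvalues * Uᴴ := by
    refine ⟨hK.1.eigenvectorUnitary, ?_, ?_, ?_⟩
    · exact Unitary.coe_mul_star_self hK.1.eigenvectorUnitary
    · exact Unitary.coe_star_mul_self hK.1.eigenvectorUnitary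
    · exact hK.1.spectral_theorem
  generalize hK.1.eigenvalues = lam at heig hKU
  have hmul : ∀ d e : Fin m → ℝ, (U * diagonal d * Uᴴ) * (U * diagonal e * Uᴴ)
      = U * diagonal (fun i => d i * e i) * Uᴴ := by
    intro d e
    calc _ = U * diagonal d * (Uᴴ * U) * diagonal e * Uᴴ := by simp only [Matrix.mul_assoc]
      _ = _ := by rw [hUU2, Matrix.mul_one, Matrix.mul_assoc U, diagonal_mul_diagonal]
  set a : ℝ → Fin m → ℝ := fun r i => α r ^ 2 * lam i + (1 - α r ^ 2) with ha
  have hAa : ∀ r, A r = U * diagonal (a r) * Uᴴ := by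
    intro r
    have : diagonal (a r) = α r ^ 2 • diagonal lam
        + (1 - α r ^ 2) • (1 : Matrix (Fin m) (Fin m) ℝ) := by
      ext i j
      by_cases hij : i = j
      · subst hij; simp [ha]
      · simp [hij]
    rw [this, hA, hKU, Matrix.mul_add, Matrix.add_mul]
    rw [Matrix.mul_smul, Matrix.smul_mul, Matrix.mul_smul, Matrix.smul_mul, Matrix.mul_one, hUU]
  have hapos : ∀ r ∈ Set.Icc (0 : ℝ) 1, ∀ i, 0 < a r i := by
    intro r hr i
    obtain ⟨h1, h2⟩ := hαrange r hr
    have h3 : 0 < α r ^ 2 * lam i := mul_pos (by positivity) (heig i).1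
    have h4 : α r ^ 2 ≤ 1 := by nlinarith
    simp only [ha]
    linarith
  have hS : ∀ r ∈ Set.Icc (0 : ℝ) 1, sqrtA r = U * diagonal (fun i => √(a r i)) * Uᴴ := by
    intro r hr
    refine psd_sqrt_unique_aux (hsqrtA r hr).1 ?_ ?_
    · exact (posSemidef_diagonal_iff.2 fun i => Real.sqrt_nonneg _).mul_mul_conjTranspose_same U
    · rw [(hsqrtA r hr).2, hmul, hAa]
      congr 3
      ext i
      exact (Real.mul_self_sqrt (hapos r hr i).le).symm
  have hinv : (A t)⁻¹ = U * diagonal (fun i => (a t i)⁻¹) * Uᴴ := by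
    apply Matrix.inv_eq_right_inv
    rw [hAa, hmul]
    have : (fun i => a t i * (a t i)⁻¹) = fun _ => (1 : ℝ) := by
      ext i
      exact mul_inv_cancel₀ (hapos t ht i).ne'
    rw [this, diagonal_one, Matrix.mul_one, hUU]
  have hαt : α t ≠ 0 := (hαrange t ht).1.ne'
  set c : ℝ := (1 / 2 : ℝ) * β t with hc
  have hcα : -c * α t = α' t := by
    rw [hc, hβ]; field_simp
  have hvec : ∀ (d : Fin m → ℝ), (U * diagonal d * Uᴴ) *ᵥ z
      = U *ᵥ (fun i => d i * (Uᴴ *ᵥ z) i) := by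
    intro d
    rw [← mulVec_mulVec, ← mulVec_mulVec]
    congr 1
    ext i
    rw [mulVec_diagonal]
  have hs : ∀ i, HasDerivWithinAt (fun r => √(a r i))
      (-c * (√(a t i) - (a t i)⁻¹ * √(a t i))) (Set.Icc (0 : ℝ) 1) t := by
    intro i
    have h1 : HasDerivWithinAt (fun r => a r i) _ (Set.Icc (0 : ℝ) 1) t :=
      (((hα t ht).fun_pow 2).mul_const (lam i)).add (((hα t ht).fun_pow 2).const_sub 1)
    convert h1.sqrt (hapos t ht i).ne' using 1
    have hp := hapos t ht i
    have hsp : 0 < √(a t i) := Real.sqrt_pos.2 hp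
    have hsq : √(a t i) ^ 2 = a t i := Real.sq_sqrt hp.le
    have hae : a t i = α t ^ 2 * lam i + (1 - α t ^ 2) := rfl
    rw [← hcα]
    generalize √(a t i) = s at *
    rw [← hsq] at hae ⊢
    field_simp
    simp
    linear_combination (-2 * c) * hae
  have hmain : HasDerivWithinAt (fun r => α r • mstar + U *ᵥ (fun i => √(a r i) * (Uᴴ *ᵥ z) i))
      (α' t • mstar + U *ᵥ (fun i => (-c * (√(a t i) - (a t i)⁻¹ * √(a t i))) * (Uᴴ *ᵥ z) i))
      (Set.Icc (0 : ℝ) 1) t := by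
    refine ((hα t ht).smul_const mstar).add ?_
    rw [hasDerivWithinAt_pi]
    intro j
    simp only [mulVec, dotProduct]
    exact HasDerivWithinAt.fun_sum fun i _ => ((hs i).mul_const _).const_mul _
  have hfr : ∀ r ∈ Set.Icc (0 : ℝ) 1,
      f r = α r • mstar + U *ᵥ (fun i => √(a r i) * (Uᴴ *ᵥ z) i) := by
    intro r hr
    rw [hf r hr, hb, hS r hr, hvec]
  refine (hmain.congr hfr (hfr t ht)).congr_deriv ?_
  have h2 : (A t)⁻¹ *ᵥ (sqrtA t *ᵥ z)
      = U *ᵥ (fun i => ((a t i)⁻¹ * √(a t i)) * (Uᴴ *ᵥ z) i) := by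
    rw [mulVec_mulVec, hinv, hS t ht, hmul, hvec]
  have h3 : sqrtA t *ᵥ z = U *ᵥ (fun i => √(a t i) * (Uᴴ *ᵥ z) i) := by
    rw [hS t ht, hvec]
  have h4 : (fun i => (-c * (√(a t i) - (a t i)⁻¹ * √(a t i))) * (Uᴴ *ᵥ z) i)
      = (-c) • ((fun i => √(a t i) * (Uᴴ *ᵥ z) i)
        - (fun i => ((a t i)⁻¹ * √(a t i)) * (Uᴴ *ᵥ z) i)) := by
    ext i
    simp only [Pi.smul_apply, Pi.sub_apply, smul_eq_mul]
    ring
  rw [h4, mulVec_smul, mulVec_sub, ← h2, ← h3, hf t ht, sub_mulVec, one_mulVec, mulVec_add,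
    ← hcα, mul_smul, ← hb]
  module
end

section
/- Let p : ℝ → ℝ be a measurable probability density (p ≥ 0 and ∫ p = 1) with finite first absolute moment ∫ |y| p(y) dy < ∞, and let α ∈ (0, 1] and σ > 0. Define the Gaussian-smoothed density q(x) := ∫ (2πσ²)^{−1/2} exp(−(x − α y)²/(2σ²)) p(y) dy and the vector field M(x) := ∫ y (2πσ²)^{−1/2} exp(−(x − α y)²/(2σ²)) p(y) dy. Then q is differentiable on ℝ, with q'(x) = −σ^{−2} (x q(x) − α M(x)) for every x; equivalently, at every x with q(x) > 0, the score satisfies (log q)'(x) = −σ^{−2} (x − α · M(x)/q(x)), i.e. the score of the smoothed density is determined by the conditional mean E[y | x] = M(x)/q(x) of the clean variable given the noisy one. -/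
open MeasureTheory

/-- One-dimensional Fisher/Tweedie identity: for a measurable probability density `p` with
finite first absolute moment, `α ∈ (0, 1]`, `σ > 0`, the Gaussian-smoothed density
`q(x) := ∫ (2πσ²)^{−1/2} exp(−(x − αy)²/(2σ²)) p(y) dy` and
`M(x) := ∫ y (2πσ²)^{−1/2} exp(−(x − αy)²/(2σ²)) p(y) dy` satisfy: `q` is differentiable
with `q'(x) = −σ⁻²(x q(x) − α M(x))`; equivalently, wherever `q(x) > 0`, the score
satisfies `(log q)'(x) = −σ⁻²(x − α M(x)/q(x))`. -/
theorem stmt10 (p : ℝ → ℝ) (hmeas : Measurable p) (hnn : ∀ y, 0 ≤ p y)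
    (hprob : ∫ y, p y = 1)
    (hmom : Integrable (fun y => |y| * p y))
    (α σ : ℝ) (hα : α ∈ Set.Ioc (0 : ℝ) 1) (hσ : 0 < σ)
    (q M : ℝ → ℝ)
    (hq : ∀ x, q x = ∫ y,
      (Real.sqrt (2 * Real.pi * σ ^ 2))⁻¹ * Real.exp (-(x - α * y) ^ 2 / (2 * σ ^ 2)) * p y)
    (hM : ∀ x, M x = ∫ y,
      y * ((Real.sqrt (2 * Real.pi * σ ^ 2))⁻¹ *
        Real.exp (-(x - α * y) ^ 2 / (2 * σ ^ 2)) * p y)) :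
    (∀ x, HasDerivAt q (-(σ ^ 2)⁻¹ * (x * q x - α * M x)) x) ∧
    (∀ x, 0 < q x →
      HasDerivAt (fun u => Real.log (q u)) (-(σ ^ 2)⁻¹ * (x - α * (M x / q x))) x) := by
  have hp : Integrable p := by
    by_contra h
    rw [integral_undef h] at hprob
    exact zero_ne_one hprob
  have hα0 : 0 ≤ α := hα.1.le
  obtain ⟨c, hc⟩ : ∃ c, c = (Real.sqrt (2 * Real.pi * σ ^ 2))⁻¹ := ⟨_, rfl⟩
  have hc0 : 0 ≤ c := by rw [hc]; positivity
  rw [← hc] at hq hM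
  obtain ⟨g, hg⟩ : ∃ g : ℝ → ℝ → ℝ, g = fun x y =>
    c * Real.exp (-(x - α * y) ^ 2 / (2 * σ ^ 2)) * p y := ⟨_, rfl⟩
  have hq' : ∀ x, q x = ∫ y, g x y := by intro x; rw [hq, hg]
  have hM' : ∀ x, M x = ∫ y, y * g x y := by intro x; rw [hM, hg]
  have hgm : ∀ x, Measurable (g x) := by
    intro x; rw [hg]; fun_prop
  have hg0 : ∀ x y, 0 ≤ g x y := by
    intro x y; rw [hg]; have := hnn y; positivity
  have hgle : ∀ x y, g x y ≤ c * p y := by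
    intro x y
    rw [hg]
    have h1 : Real.exp (-(x - α * y) ^ 2 / (2 * σ ^ 2)) ≤ 1 := by
      rw [Real.exp_le_one_iff]
      apply div_nonpos_of_nonpos_of_nonneg
      · have := sq_nonneg (x - α * y); linarith
      · positivity
    have := hnn y
    exact mul_le_mul_of_nonneg_right (mul_le_of_le_one_right hc0 h1) this
  have hgi : ∀ x, Integrable (g x) := by
    intro x
    refine (hp.const_mul c).mono' (hgm x).aestronglyMeasurable (Filter.Eventually.of_forall ?_)
    intro y
    rw [Real.norm_eq_abs, abs_of_nonneg (hg0 x y)]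
    exact hgle x y
  have hyle : ∀ x y, |y * g x y| ≤ c * (|y| * p y) := by
    intro x y
    rw [abs_mul, abs_of_nonneg (hg0 x y)]
    have := mul_le_mul_of_nonneg_left (hgle x y) (abs_nonneg y)
    linarith
  have hygi : ∀ x, Integrable (fun y => y * g x y) := by
    intro x
    exact (hmom.const_mul c).mono' (measurable_id.mul (hgm x)).aestronglyMeasurable
      (Filter.Eventually.of_forall (hyle x))
  have main : ∀ x, HasDerivAt q (-(σ ^ 2)⁻¹ * (x * q x - α * M x)) x := by
    intro x
    have key := hasDerivAt_integral_of_dominated_loc_of_deriv_le (μ := volume) (F := g)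
      (F' := fun x y => -(σ ^ 2)⁻¹ * (x * g x y - α * (y * g x y)))
      (bound := fun y => (σ ^ 2)⁻¹ * ((|x| + 1) * (c * p y) + α * (c * (|y| * p y))))
      (Metric.ball_mem_nhds x one_pos)
      (Filter.Eventually.of_forall fun u => (hgm u).aestronglyMeasurable) (hgi x)
      ((((hgi x).const_mul x).sub ((hygi x).const_mul α)).const_mul _).aestronglyMeasurable
      (Filter.Eventually.of_forall ?_)
      ((((hp.const_mul c).const_mul _).add ((hmom.const_mul c).const_mul α)).const_mul _)
      (Filter.Eventually.of_forall ?_)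
    · have h2 := key.2
      have e : (fun n => ∫ a, g n a) = q := by funext n; rw [hq']
      rw [e, integral_const_mul, integral_sub ((hgi x).const_mul x) ((hygi x).const_mul α),
        integral_const_mul, integral_const_mul, ← hq', ← hM'] at h2
      exact h2
    · intro y u hu
      rw [Metric.mem_ball, Real.dist_eq] at hu
      have hu' : |u| ≤ |x| + 1 := by
        have := abs_sub_abs_le_abs_sub u x
        linarith
      rw [norm_mul, norm_neg, Real.norm_of_nonneg (by positivity : 0 ≤ (σ ^ 2)⁻¹)]
      refine mul_le_mul_of_nonneg_left ?_ (by positivity)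
      refine (norm_sub_le _ _).trans (add_le_add ?_ ?_)
      · rw [norm_mul, Real.norm_eq_abs, Real.norm_eq_abs, abs_of_nonneg (hg0 u y)]
        exact mul_le_mul hu' (hgle u y) (hg0 u y) (by positivity)
      · rw [norm_mul, Real.norm_of_nonneg hα0]
        exact mul_le_mul_of_nonneg_left (hyle u y) hα0
    · intro y u _
      rw [hg]
      have h1 : HasDerivAt (fun u : ℝ => -(u - α * y) ^ 2 / (2 * σ ^ 2))
          (-(2 * (u - α * y)) / (2 * σ ^ 2)) u := by
        have := ((((hasDerivAt_id u).sub_const (α * y)).pow 2).neg).div_const (2 * σ ^ 2)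
        simpa using this
      have h2 := ((h1.exp).const_mul c).mul_const (p y)
      refine h2.congr_deriv ?_
      field_simp
  refine ⟨main, fun x hx => ?_⟩
  refine ((main x).log hx.ne').congr_deriv ?_
  field_simp
end

section
/- Let K be a real symmetric positive definite matrix whose eigenvalues λ_max := λ_1 ≥ … ≥ λ_n =: λ_min all lie in (0, 1), and let α² : [0, 1] → (0, 1] be monotonically decreasing with α²(0) = 1. For t ∈ [0, 1] define λ_i(t) := 1 + α²(t)(λ_i − 1) and the stiffness stiffness(t) := (λ_1(t)/λ_n(t)) · (1 − λ_n(t))/(1 − λ_1(t)). Then stiffness(t) is non-increasing in t on [0, 1], so its maximum over [0, 1] is attained at t = 0, where it equals κ(K) · (1 − λ_min)/(1 − λ_max) with κ(K) := λ_max/λ_min. -/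
open Matrix

/-- Maximal stiffness of the GP probability-flow ODE: for a real symmetric positive
definite matrix `K` with eigenvalues in `(0, 1)`, extreme eigenvalues `λ_max ≥ λ_min`, and
a monotonically decreasing `α² : [0, 1] → (0, 1]` with `α²(0) = 1`, the stiffness
`stiffness(t) := (λ_1(t)/λ_n(t))·(1 − λ_n(t))/(1 − λ_1(t))`, where
`λ_i(t) := 1 + α²(t)(λ_i − 1)`, is non-increasing in `t` on `[0, 1]`; hence its maximum is
attained at `t = 0`, where it equals `κ(K)·(1 − λ_min)/(1 − λ_max)`, `κ(K) = λ_max/λ_min`. -/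
theorem stmt16 {n : ℕ} (K : Matrix (Fin (n + 1)) (Fin (n + 1)) ℝ) (hK : K.PosDef)
    (heig : ∀ i, hK.1.eigenvalues i ∈ Set.Ioo (0 : ℝ) 1)
    (lammax lammin : ℝ)
    (hmax : lammax = Finset.univ.sup' Finset.univ_nonempty hK.1.eigenvalues)
    (hmin : lammin = Finset.univ.inf' Finset.univ_nonempty hK.1.eigenvalues)
    (α2 : ℝ → ℝ) (hmono : AntitoneOn α2 (Set.Icc (0 : ℝ) 1)) (h0 : α2 0 = 1)
    (hrange : ∀ t ∈ Set.Icc (0 : ℝ) 1, α2 t ∈ Set.Ioc (0 : ℝ) 1)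
    (lam1 lamn stiffness : ℝ → ℝ)
    (hlam1 : ∀ t, lam1 t = 1 + α2 t * (lammax - 1))
    (hlamn : ∀ t, lamn t = 1 + α2 t * (lammin - 1))
    (hstiff : ∀ t, stiffness t = (lam1 t / lamn t) * ((1 - lamn t) / (1 - lam1 t))) :
    AntitoneOn stiffness (Set.Icc (0 : ℝ) 1) ∧
    (∀ t ∈ Set.Icc (0 : ℝ) 1, stiffness t ≤ stiffness 0) ∧
    stiffness 0 = (lammax / lammin) * ((1 - lammin) / (1 - lammax)) := by
  obtain ⟨i, -, hi⟩ := Finset.exists_mem_eq_sup' Finset.univ_nonempty hK.1.eigenvalues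
  obtain ⟨j, -, hj⟩ := Finset.exists_mem_eq_inf' Finset.univ_nonempty hK.1.eigenvalues
  have hle : lammin ≤ lammax := by
    rw [hmax, hmin, hj]
    exact Finset.le_sup' hK.1.eigenvalues (Finset.mem_univ j)
  have h1 : lammax < 1 := by rw [hmax, hi]; exact (heig i).2
  have h2 : 0 < lammin := by rw [hmin, hj]; exact (heig j).1
  have key : ∀ t ∈ Set.Icc (0 : ℝ) 1, stiffness t =
      ((1 + α2 t * (lammax - 1)) / (1 + α2 t * (lammin - 1))) *
        ((1 - lammin) / (1 - lammax)) := by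
    intro t ht
    have ha := (hrange t ht).1
    rw [hstiff, hlam1, hlamn]
    have e1 : 1 - (1 + α2 t * (lammin - 1)) = α2 t * (1 - lammin) := by ring
    have e2 : 1 - (1 + α2 t * (lammax - 1)) = α2 t * (1 - lammax) := by ring
    rw [e1, e2, mul_div_mul_left _ _ ha.ne']
  have pos : ∀ t ∈ Set.Icc (0 : ℝ) 1, 0 < 1 + α2 t * (lammin - 1) := by
    intro t ht
    have ha := hrange t ht
    nlinarith [ha.1, ha.2]
  have anti : AntitoneOn stiffness (Set.Icc (0 : ℝ) 1) := by
    intro s hs t ht hst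
    have hab := hmono hs ht hst
    rw [key s hs, key t ht]
    apply mul_le_mul_of_nonneg_right
    · rw [div_le_div_iff₀ (pos t ht) (pos s hs)]
      nlinarith [mul_nonneg (sub_nonneg.2 hab) (sub_nonneg.2 hle)]
    · exact div_nonneg (by linarith) (by linarith)
  have m0 : (0 : ℝ) ∈ Set.Icc (0 : ℝ) 1 := ⟨le_rfl, zero_le_one⟩
  refine ⟨anti, fun t ht => anti m0 ht ht.1, ?_⟩
  rw [key 0 m0, h0]
  simp
end
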